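/- arXiv:2412.13972 — 2 statements merged into one kernel-verified Lean document; each statement's English description precedes it below -/
import Mathlib

section
/- Every 2-sparse market in which all agents have fully-substitutable demands converges almost surely to equilibrium: with probability 1 over the uniformly random selection of an unsatisfied agent at each step, the market dynamic terminates after finitely many best responses. -/
open Finset

/-- A trading market: a set `I` of agents, a set `Ω` of bilateral trades, each with a
buyer and a distinct seller, integer-valued valuations over bundles of trades, and a
(unique, tie-broken) demanded bundle at every price vector. -/
structure Market (I Ω : Type) [DecidableEq I] where
  buyer : Ω → I
  seller : Ω → I
  buyer_ne_seller : ∀ ω, buyer ω ≠ seller ω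
  v : I → Finset Ω → ℤ
  demand : I → (Ω → ℤ) → Finset Ω
  demand_involves : ∀ i p, ∀ ω ∈ demand i p, buyer ω = i ∨ seller ω = i
  demand_max : ∀ (i : I) (p : Ω → ℤ) (Ψ : Finset Ω),
    (∀ ω ∈ Ψ, buyer ω = i ∨ seller ω = i) →
    v i Ψ - ∑ ω ∈ Ψ, (if buyer ω = i then (1 : ℤ) else if seller ω = i then -1 else 0) * p ω ≤
      v i (demand i p) -
        ∑ ω ∈ demand i p,
          (if buyer ω = i then (1 : ℤ) else if seller ω = i then -1 else 0) * p ω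

/-- A state of the market dynamic: the set of unsatisfied agents and the current offers
`offers i ω` of agent `i` for trade `ω`. -/
structure MState (I Ω : Type) where
  unsat : Finset I
  offers : I → Ω → ℤ

namespace Market

variable {I Ω : Type} [Fintype I] [DecidableEq I] [Fintype Ω] [DecidableEq Ω]

/-- The sign `χ^i_ω`: `1` if `i` buys `ω`, `-1` if `i` sells `ω`, `0` otherwise. -/
def chi (M : Market I Ω) (i : I) (ω : Ω) : ℤ :=
  if M.buyer ω = i then 1 else if M.seller ω = i then -1 else 0

/-- Quasilinear utility of agent `i` for bundle `Ψ` at prices `p`. -/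
def utility (M : Market I Ω) (i : I) (Ψ : Finset Ω) (p : Ω → ℤ) : ℤ :=
  M.v i Ψ - ∑ ω ∈ Ψ, M.chi i ω * p ω

/-- The valuation of the empty bundle is `0`. -/
def Normalized (M : Market I Ω) : Prop := ∀ i : I, M.v i (∅ : Finset Ω) = 0

/-- The prices facing agent `i`: the counterpart's offer `σ^{-i}_ω` for each trade `ω`. -/
def price (M : Market I Ω) (σ : I → Ω → ℤ) (i : I) (ω : Ω) : ℤ :=
  if M.buyer ω = i then σ (M.seller ω) ω else σ (M.buyer ω) ω

/-- The best response (with step size `ε = 1`) of agent `i` given current offers `σ`: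
she matches the counterpart's offer on the trades she demands, and moves off by `1`
(in her favourable direction) otherwise.  Offers of other agents are unchanged. -/
def bestResponse (M : Market I Ω) (σ : I → Ω → ℤ) (i : I) : I → Ω → ℤ := fun j ω =>
  if j = i ∧ (M.buyer ω = i ∨ M.seller ω = i) then
    (if ω ∈ M.demand i (M.price σ i) then M.price σ i ω
     else M.price σ i ω - M.chi i ω)
  else σ j ω

/-- One step of the market dynamic: agent `i` best responds, becomes satisfied, and all
counterparts facing a modified offer become unsatisfied. -/
def mstep (M : Market I Ω) (s : MState I Ω) (i : I) : MState I Ω :=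
  { unsat := (s.unsat.erase i) ∪ (Finset.univ.filter fun j =>
      j ≠ i ∧ ∃ ω : Ω,
        ((M.buyer ω = i ∧ M.seller ω = j) ∨ (M.buyer ω = j ∧ M.seller ω = i)) ∧
        M.bestResponse s.offers i i ω ≠ s.offers i ω),
    offers := M.bestResponse s.offers i }

/-- Running the dynamic along a finite sequence of best-responding agents. -/
def mrun (M : Market I Ω) : MState I Ω → List I → MState I Ω
  | s, [] => s
  | s, i :: L => M.mrun (M.mstep s i) L

/-- A best response sequence of the dynamic is valid if every selected agent is
unsatisfied when selected. -/
def ValidSeq (M : Market I Ω) : MState I Ω → List I → Prop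
  | _, [] => True
  | s, i :: L => i ∈ s.unsat ∧ M.ValidSeq (M.mstep s i) L

/-- A (valid) best response sequence after which the market dynamic terminates, i.e.,
all agents are satisfied. -/
def TerminatingSeq (M : Market I Ω) (s : MState I Ω) (L : List I) : Prop :=
  M.ValidSeq s L ∧ (M.mrun s L).unsat = ∅

/-- Full substitutability of the demand of agent `i` (Hatfield et al.). -/
def FullySubstitutable (M : Market I Ω) (i : I) : Prop :=
  ∀ p p' : Ω → ℤ,
    (((∀ ω, M.seller ω = i → p ω = p' ω) ∧ (∀ ω, M.buyer ω = i → p' ω ≤ p ω)) →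
      ((∀ ω ∈ M.demand i p, M.seller ω = i → ω ∈ M.demand i p') ∧
       (∀ ω ∈ M.demand i p', M.buyer ω = i → p ω = p' ω → ω ∈ M.demand i p))) ∧
    (((∀ ω, M.buyer ω = i → p ω = p' ω) ∧ (∀ ω, M.seller ω = i → p ω ≤ p' ω)) →
      ((∀ ω ∈ M.demand i p, M.buyer ω = i → ω ∈ M.demand i p') ∧
       (∀ ω ∈ M.demand i p', M.seller ω = i → p ω = p' ω → ω ∈ M.demand i p)))

/-- A market with fully substitutable agents. -/
def FSM (M : Market I Ω) : Prop := ∀ i : I, M.FullySubstitutable i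

end Market

namespace Market

variable {I Ω : Type} [Fintype I] [DecidableEq I] [Fintype Ω] [DecidableEq Ω]

/-- The trades crossing between the agent sets `A` and `B`. -/
def crossEdges (M : Market I Ω) (A B : Finset I) : Finset Ω :=
  Finset.univ.filter fun ω =>
    (M.buyer ω ∈ A ∧ M.seller ω ∈ B) ∨ (M.buyer ω ∈ B ∧ M.seller ω ∈ A)

/-- A market is `m`-sparse if every induced subgraph of its underlying multigraph can be
split into two nonempty parts with at most `m` crossing trades. -/
def Sparse (M : Market I Ω) (m : ℕ) : Prop :=
  ∀ S : Finset I, 2 ≤ S.card →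
    ∃ A : Finset I, A ⊆ S ∧ A.Nonempty ∧ (S \ A).Nonempty ∧
      (M.crossEdges A (S \ A)).card ≤ m

/-- The underlying multigraph of the market is a forest: every induced subgraph has
fewer edges than vertices. -/
def IsForest (M : Market I Ω) : Prop :=
  ∀ S : Finset I, S.Nonempty →
    (Finset.univ.filter fun ω => M.buyer ω ∈ S ∧ M.seller ω ∈ S).card + 1 ≤ S.card

end Market

namespace Market

variable {I Ω : Type} [Fintype I] [DecidableEq I] [Fintype Ω] [DecidableEq Ω]

/-- `termProb M s n` is the probability that the market dynamic — which repeatedly selects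
an unsatisfied agent uniformly at random to best respond — has terminated (no agent is
unsatisfied) within `n` steps, starting from state `s`. -/
noncomputable def termProb (M : Market I Ω) : MState I Ω → ℕ → ℝ
  | s, 0 => if s.unsat = ∅ then 1 else 0
  | s, n + 1 =>
      if s.unsat = ∅ then 1
      else (s.unsat.card : ℝ)⁻¹ * ∑ i ∈ s.unsat, M.termProb (M.mstep s i) n

/-- The market dynamic terminates after finitely many best responses with probability 1
over the uniformly random selection of an unsatisfied agent at each step. -/
def ConvergesAlmostSurely (M : Market I Ω) (s : MState I Ω) : Prop :=
  Filter.Tendsto (fun n => M.termProb s n) Filter.atTop (nhds 1)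

end Market

namespace Market

section Dynamics

set_option linter.unusedSectionVars false

variable {I Ω : Type} [Fintype I] [DecidableEq I] [Fintype Ω] [DecidableEq Ω]

/-- The offer with which agent `i` responds to the price vector `p` on trade `ω`. -/
def response (M : Market I Ω) (i : I) (p : Ω → ℤ) (ω : Ω) : ℤ :=
  if ω ∈ M.demand i p then p ω else p ω - M.chi i ω

/-- The trade `ω` involves agent `i`. -/
def Involves (M : Market I Ω) (i : I) (ω : Ω) : Prop := M.buyer ω = i ∨ M.seller ω = i

theorem response_of_buyer (M : Market I Ω) {i : I} {ω : Ω} (h : M.buyer ω = i) (p : Ω → ℤ) :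
    M.response i p ω = if ω ∈ M.demand i p then p ω else p ω - 1 := by
  simp [response, chi, h]

theorem response_of_seller (M : Market I Ω) {i : I} {ω : Ω} (h : M.seller ω = i) (p : Ω → ℤ) :
    M.response i p ω = if ω ∈ M.demand i p then p ω else p ω + 1 := by
  have hb : M.buyer ω ≠ i := h ▸ M.buyer_ne_seller ω
  simp [response, chi, h, hb]

/-- Under full substitutability the best response is monotone in the prices faced. -/
theorem FullySubstitutable.response_mono {M : Market I Ω} {i : I}
    (h : M.FullySubstitutable i) {p q : Ω → ℤ} (hpq : ∀ ω, M.Involves i ω → p ω ≤ q ω)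
    {ω : Ω} (hω : M.Involves i ω) : M.response i p ω ≤ M.response i q ω := by
  set r : Ω → ℤ := fun ω => if M.buyer ω = i then q ω else p ω with hr
  have hrb : ∀ ω, M.buyer ω = i → r ω = q ω := fun ω hω => by simp [hr, hω]
  have hrs : ∀ ω, M.seller ω = i → r ω = p ω := fun ω hω => by
    have hb : M.buyer ω ≠ i := hω ▸ M.buyer_ne_seller ω
    simp [hr, hb]
  obtain ⟨h1, h2⟩ := (h r p).1 ⟨hrs, fun ω hω => (hrb ω hω).symm ▸ hpq ω (Or.inl hω)⟩
  obtain ⟨h3, h4⟩ := (h r q).2 ⟨hrb, fun ω hω => (hrs ω hω).symm ▸ hpq ω (Or.inr hω)⟩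
  have hle := hpq ω hω
  rcases hω with hω | hω
  · rw [M.response_of_buyer hω, M.response_of_buyer hω]
    rcases hle.lt_or_eq with hlt | heq
    · split_ifs <;> omega
    · by_cases hm : ω ∈ M.demand i p
      · have : ω ∈ M.demand i q := h3 ω (h2 ω hm hω (by rw [hrb ω hω, heq])) hω
        simp [hm, this, heq]
      · split_ifs <;> omega
  · rw [M.response_of_seller hω, M.response_of_seller hω]
    rcases hle.lt_or_eq with hlt | heq
    · split_ifs <;> omega
    · by_cases hm : ω ∈ M.demand i q
      · have : ω ∈ M.demand i p := h1 ω (h4 ω hm hω (by rw [hrs ω hω, heq])) hω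
        simp [hm, this, heq]
      · split_ifs <;> omega

theorem bestResponse_self (M : Market I Ω) (σ : I → Ω → ℤ) {i : I} {ω : Ω}
    (h : M.Involves i ω) : M.bestResponse σ i i ω = M.response i (M.price σ i) ω := by
  unfold Involves at h
  simp [bestResponse, response, h]

theorem bestResponse_of_not_involves (M : Market I Ω) (σ : I → Ω → ℤ) {i : I} (j : I) {ω : Ω}
    (h : ¬ M.Involves i ω) : M.bestResponse σ i j ω = σ j ω := by
  unfold Involves at h
  simp [bestResponse, h]

theorem bestResponse_of_ne (M : Market I Ω) (σ : I → Ω → ℤ) {i j : I} (h : j ≠ i) :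
    M.bestResponse σ i j = σ j := by
  funext ω
  simp [bestResponse, h]

theorem price_of_buyer (M : Market I Ω) (σ : I → Ω → ℤ) {i : I} {ω : Ω}
    (h : M.buyer ω = i) : M.price σ i ω = σ (M.seller ω) ω := by
  simp [price, h]

theorem price_of_seller (M : Market I Ω) (σ : I → Ω → ℤ) {i : I} {ω : Ω}
    (h : M.seller ω = i) : M.price σ i ω = σ (M.buyer ω) ω := by
  have hb : M.buyer ω ≠ i := h ▸ M.buyer_ne_seller ω
  simp [price, hb]

theorem FSM.bestResponse_mono {M : Market I Ω} (h : M.FSM) (i : I) :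
    Monotone fun σ => M.bestResponse σ i := by
  intro σ τ hστ j ω
  by_cases hji : j = i
  · subst hji
    by_cases hω : M.Involves j ω
    · simp only [M.bestResponse_self _ hω]
      refine (h j).response_mono (fun ω hω => ?_) hω
      unfold price
      split_ifs
      exacts [hστ _ _, hστ _ _]
    · simp only [M.bestResponse_of_not_involves _ _ hω]
      exact hστ _ _
  · simp only [M.bestResponse_of_ne _ hji]
    exact hστ _ _

theorem FSM.response_congr {M : Market I Ω} (h : M.FSM) {i : I} {p q : Ω → ℤ}
    (hpq : ∀ ω, M.Involves i ω → p ω = q ω) {ω : Ω} (hω : M.Involves i ω) :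
    M.response i p ω = M.response i q ω :=
  le_antisymm ((h i).response_mono (fun ω hω => (hpq ω hω).le) hω)
    ((h i).response_mono (fun ω hω => (hpq ω hω).ge) hω)

theorem price_congr (M : Market I Ω) {σ τ : I → Ω → ℤ} {i : I}
    (h : ∀ j, j ≠ i → σ j = τ j) {ω : Ω} (hω : M.Involves i ω) :
    M.price σ i ω = M.price τ i ω := by
  rcases hω with hω | hω
  · rw [M.price_of_buyer _ hω, M.price_of_buyer _ hω, h]
    exact fun hs => M.buyer_ne_seller ω (hω.trans hs.symm)
  · rw [M.price_of_seller _ hω, M.price_of_seller _ hω, h]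
    exact fun hs => M.buyer_ne_seller ω (hs.trans hω.symm)

theorem FSM.bestResponse_idem {M : Market I Ω} (h : M.FSM) (σ : I → Ω → ℤ) (i : I) :
    M.bestResponse (M.bestResponse σ i) i = M.bestResponse σ i := by
  funext j ω
  by_cases hji : j = i
  · subst hji
    by_cases hω : M.Involves j ω
    · simp only [M.bestResponse_self _ hω]
      exact h.response_congr
        (fun ω hω => M.price_congr (fun k hk => M.bestResponse_of_ne σ hk) hω) hω
    · rw [M.bestResponse_of_not_involves _ _ hω]
  · rw [M.bestResponse_of_ne _ hji]

/-- If two agents both weakly raise their offers by best responding, the second still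
does so after the first has responded. -/
theorem FSM.le_bestResponse_bestResponse {M : Market I Ω} (h : M.FSM) {σ : I → Ω → ℤ} {i j : I}
    (hi : σ ≤ M.bestResponse σ i) (hj : σ ≤ M.bestResponse σ j) :
    M.bestResponse σ i ≤ M.bestResponse (M.bestResponse σ i) j := by
  by_cases hji : j = i
  · rw [hji, h.bestResponse_idem]
  · intro k
    by_cases hk : k = j
    · subst hk
      rw [M.bestResponse_of_ne σ hji]
      exact (hj k).trans (h.bestResponse_mono k hi k)
    · rw [M.bestResponse_of_ne _ hk]

theorem FSM.bestResponse_bestResponse_le {M : Market I Ω} (h : M.FSM) {σ : I → Ω → ℤ} {i j : I}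
    (hi : M.bestResponse σ i ≤ σ) (hj : M.bestResponse σ j ≤ σ) :
    M.bestResponse (M.bestResponse σ i) j ≤ M.bestResponse σ i := by
  by_cases hji : j = i
  · rw [hji, h.bestResponse_idem]
  · intro k
    by_cases hk : k = j
    · subst hk
      rw [M.bestResponse_of_ne σ hji]
      exact (h.bestResponse_mono k hi k).trans (hj k)
    · rw [M.bestResponse_of_ne _ hk]

/-- The offers `τ` can be reached from `σ` by best responses of agents in `S`. -/
def Reach (M : Market I Ω) (S : Finset I) : (I → Ω → ℤ) → (I → Ω → ℤ) → Prop :=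
  Relation.ReflTransGen fun σ τ => ∃ i ∈ S, τ = M.bestResponse σ i

/-- Every agent in `S` is currently best responding. -/
def FixedOn (M : Market I Ω) (S : Finset I) (σ : I → Ω → ℤ) : Prop :=
  ∀ i ∈ S, M.bestResponse σ i = σ

/-- The set `T` of offer profiles is preserved by all best responses. -/
def Closed (M : Market I Ω) (T : Finset (I → Ω → ℤ)) : Prop :=
  ∀ σ ∈ T, ∀ i, M.bestResponse σ i ∈ T

/-- From every offer profile in `T` the agents in `S` can all be satisfied by best
responses of agents in `S`. -/
def Settles (M : Market I Ω) (T : Finset (I → Ω → ℤ)) (S : Finset I) : Prop :=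
  ∀ σ ∈ T, ∃ τ, M.Reach S σ τ ∧ M.FixedOn S τ

theorem Reach.mono {M : Market I Ω} {S S' : Finset I} (h : S ⊆ S') {σ τ : I → Ω → ℤ}
    (hr : M.Reach S σ τ) : M.Reach S' σ τ :=
  Relation.ReflTransGen.mono (fun _ _ ⟨i, hi, he⟩ => ⟨i, h hi, he⟩) _ _ hr

theorem Reach.mem {M : Market I Ω} {T : Finset (I → Ω → ℤ)} (hT : M.Closed T) {S : Finset I}
    {σ τ : I → Ω → ℤ} (hr : M.Reach S σ τ) (hσ : σ ∈ T) : τ ∈ T := by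
  induction hr with
  | refl => exact hσ
  | tail _ hs ih =>
    obtain ⟨i, _, rfl⟩ := hs
    exact hT _ ih i

theorem Reach.eq_of_notMem {M : Market I Ω} {S : Finset I} {σ τ : I → Ω → ℤ}
    (hr : M.Reach S σ τ) {j : I} (hj : j ∉ S) : τ j = σ j := by
  induction hr with
  | refl => rfl
  | tail _ hs ih =>
    obtain ⟨i, hi, rfl⟩ := hs
    rw [M.bestResponse_of_ne _ (ne_of_mem_of_not_mem hi hj).symm, ih]

/-- If best responses of the agents in `S` move monotonically along a partial order `r`
inside a finite closed set, then they settle. -/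
theorem exists_reach_fixedOn_of_monotone {M : Market I Ω} {T : Finset (I → Ω → ℤ)}
    (hT : M.Closed T) {S : Finset I} (r : (I → Ω → ℤ) → (I → Ω → ℤ) → Prop)
    (hrefl : ∀ σ, r σ σ) (htrans : ∀ {σ τ ρ}, r σ τ → r τ ρ → r σ ρ)
    (hanti : ∀ {σ τ}, r σ τ → r τ σ → σ = τ)
    (hstep : ∀ {σ i j}, r σ (M.bestResponse σ i) → r σ (M.bestResponse σ j) →
      r (M.bestResponse σ i) (M.bestResponse (M.bestResponse σ i) j))
    {σ : I → Ω → ℤ} (hσ : σ ∈ T) (h : ∀ i ∈ S, r σ (M.bestResponse σ i)) :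
    ∃ τ, M.Reach S σ τ ∧ M.FixedOn S τ := by
  classical
  induction hn : (T.filter (r σ)).card using Nat.strong_induction_on generalizing σ with
  | _ n ih =>
    by_cases hf : M.FixedOn S σ
    · exact ⟨σ, Relation.ReflTransGen.refl, hf⟩
    · unfold FixedOn at hf
      push Not at hf
      obtain ⟨i, hi, hne⟩ := hf
      have hlt : (T.filter (r (M.bestResponse σ i))).card < (T.filter (r σ)).card := by
        refine Finset.card_lt_card (Finset.ssubset_iff_of_subset ?_ |>.2 ⟨σ, ?_, ?_⟩)
        · exact Finset.monotone_filter_right _ fun τ _ hτ => htrans (h i hi) hτ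
        · simp [hσ, hrefl]
        · intro hm
          exact hne (hanti (Finset.mem_filter.1 hm).2 (h i hi))
      obtain ⟨τ, hτ, hfix⟩ := ih _ (hn ▸ hlt) (hT σ hσ i)
        (fun j hj => hstep (h i hi) (h j hj)) rfl
      exact ⟨τ, Relation.ReflTransGen.head ⟨i, hi, rfl⟩ hτ, hfix⟩

/-- The offer made for the trade `ω` by its participant in `B`. -/
def offerFrom (M : Market I Ω) (B : Finset I) (σ : I → Ω → ℤ) (ω : Ω) : ℤ :=
  if M.buyer ω ∈ B then σ (M.buyer ω) ω else σ (M.seller ω) ω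

theorem mem_crossEdges {M : Market I Ω} {A B : Finset I} {ω : Ω} :
    ω ∈ M.crossEdges A B ↔
      (M.buyer ω ∈ A ∧ M.seller ω ∈ B) ∨ (M.buyer ω ∈ B ∧ M.seller ω ∈ A) := by
  simp [crossEdges]

theorem crossEdges_comm (M : Market I Ω) (A B : Finset I) :
    M.crossEdges A B = M.crossEdges B A := by
  ext ω
  simp only [mem_crossEdges]
  tauto

/-- If only agents in `B` changed their offers, a relation between old and new offers across
the cut holds between the old and new prices faced by the agents in `A`. -/
theorem price_rel_of_crossEdges {M : Market I Ω} {A B : Finset I}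
    {σ τ : I → Ω → ℤ} (heq : ∀ j, j ∉ B → τ j = σ j)
    (r : ℤ → ℤ → Prop) (hr : ∀ x, r x x)
    (hc : ∀ ω ∈ M.crossEdges A B, r (M.offerFrom B σ ω) (M.offerFrom B τ ω))
    (hAB : Disjoint A B) {i : I} (hi : i ∈ A) {ω : Ω} (hω : M.Involves i ω) :
    r (M.price σ i ω) (M.price τ i ω) := by
  rcases hω with hω | hω
  · rw [M.price_of_buyer _ hω, M.price_of_buyer _ hω]
    by_cases hs : M.seller ω ∈ B
    · have := hc ω (mem_crossEdges.2 (Or.inl ⟨hω ▸ hi, hs⟩))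
      have hb : M.buyer ω ∉ B := fun hb => Finset.disjoint_left.1 hAB (hω ▸ hi) hb
      simpa [offerFrom, hb] using this
    · rw [heq _ hs]
      exact hr _
  · rw [M.price_of_seller _ hω, M.price_of_seller _ hω]
    by_cases hs : M.buyer ω ∈ B
    · have := hc ω (mem_crossEdges.2 (Or.inr ⟨hs, hω ▸ hi⟩))
      simpa [offerFrom, hs] using this
    · rw [heq _ hs]
      exact hr _

/-- If the agents in `A` were satisfied and those in `B`, now satisfied, have only raised
their offers across the cut, then `A ∪ B` settles. -/
theorem FSM.exists_reach_of_raised {M : Market I Ω} (h : M.FSM) {T : Finset (I → Ω → ℤ)}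
    (hT : M.Closed T) {A B : Finset I} (hAB : Disjoint A B) {σ τ : I → Ω → ℤ} (hτ : τ ∈ T)
    (hA : M.FixedOn A σ) (hB : M.FixedOn B τ) (heq : ∀ j, j ∉ B → τ j = σ j)
    (hc : ∀ ω ∈ M.crossEdges A B, M.offerFrom B σ ω ≤ M.offerFrom B τ ω) :
    ∃ ρ, M.Reach (A ∪ B) τ ρ ∧ M.FixedOn (A ∪ B) ρ := by
  refine exists_reach_fixedOn_of_monotone hT (· ≤ ·) le_refl le_trans le_antisymm
    h.le_bestResponse_bestResponse hτ fun i hi => ?_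
  rcases Finset.mem_union.1 hi with hi | hi
  · intro j
    by_cases hj : j = i
    · subst hj
      intro ω
      by_cases hω : M.Involves j ω
      · rw [M.bestResponse_self _ hω, heq j (Finset.disjoint_left.1 hAB hi), ← hA j hi,
          M.bestResponse_self _ hω]
        exact (h j).response_mono
          (fun ω hω => price_rel_of_crossEdges heq (· ≤ ·) le_refl hc hAB hi hω) hω
      · rw [M.bestResponse_of_not_involves _ _ hω]
    · rw [M.bestResponse_of_ne _ hj]
  · exact (hB i hi).ge

theorem FSM.exists_reach_of_lowered {M : Market I Ω} (h : M.FSM) {T : Finset (I → Ω → ℤ)}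
    (hT : M.Closed T) {A B : Finset I} (hAB : Disjoint A B) {σ τ : I → Ω → ℤ} (hτ : τ ∈ T)
    (hA : M.FixedOn A σ) (hB : M.FixedOn B τ) (heq : ∀ j, j ∉ B → τ j = σ j)
    (hc : ∀ ω ∈ M.crossEdges A B, M.offerFrom B τ ω ≤ M.offerFrom B σ ω) :
    ∃ ρ, M.Reach (A ∪ B) τ ρ ∧ M.FixedOn (A ∪ B) ρ := by
  refine exists_reach_fixedOn_of_monotone hT (· ≥ ·) le_refl (fun h₁ h₂ => le_trans h₂ h₁)
    (fun h₁ h₂ => le_antisymm h₂ h₁)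
    h.bestResponse_bestResponse_le hτ fun i hi => ?_
  rcases Finset.mem_union.1 hi with hi | hi
  · intro j
    by_cases hj : j = i
    · subst hj
      intro ω
      by_cases hω : M.Involves j ω
      · rw [M.bestResponse_self _ hω, heq j (Finset.disjoint_left.1 hAB hi), ← hA j hi,
          M.bestResponse_self _ hω]
        exact (h j).response_mono
          (fun ω hω => price_rel_of_crossEdges heq (· ≥ ·) le_refl hc hAB hi hω) hω
      · rw [M.bestResponse_of_not_involves _ _ hω]
    · rw [M.bestResponse_of_ne _ hj]
  · exact (hB i hi).le

theorem offer_buyer_of_fixed {M : Market I Ω} {σ : I → Ω → ℤ} {ω : Ω}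
    (h : M.bestResponse σ (M.buyer ω) = σ) :
    σ (M.buyer ω) ω = σ (M.seller ω) ω ∨ σ (M.buyer ω) ω = σ (M.seller ω) ω - 1 := by
  have hω : M.Involves (M.buyer ω) ω := Or.inl rfl
  have := congrFun (congrFun h (M.buyer ω)) ω
  rw [M.bestResponse_self _ hω, M.response_of_buyer rfl, M.price_of_buyer _ rfl] at this
  split_ifs at this <;> omega

theorem offer_seller_of_fixed {M : Market I Ω} {σ : I → Ω → ℤ} {ω : Ω}
    (h : M.bestResponse σ (M.seller ω) = σ) :
    σ (M.seller ω) ω = σ (M.buyer ω) ω ∨ σ (M.seller ω) ω = σ (M.buyer ω) ω + 1 := by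
  have hω : M.Involves (M.seller ω) ω := Or.inr rfl
  have := congrFun (congrFun h (M.seller ω)) ω
  rw [M.bestResponse_self _ hω, M.response_of_seller rfl, M.price_of_seller _ rfl] at this
  split_ifs at this <;> omega

/-- When `A`, then `B`, then `A` settle in turn, the offers of `A` on a cut trade move by at
most one, and only in the direction in which the offers of `B` moved. -/
theorem offerFrom_move {M : Market I Ω} {A B : Finset I} (hAB : Disjoint A B)
    {σ τ ρ : I → Ω → ℤ} (hA : M.FixedOn A σ) (hB : M.FixedOn B τ) (hA' : M.FixedOn A ρ)
    (heq : ∀ j, j ∉ B → τ j = σ j) (heq' : ∀ j, j ∉ A → ρ j = τ j)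
    {ω : Ω} (hω : ω ∈ M.crossEdges A B) :
    (M.offerFrom B σ ω < M.offerFrom B τ ω → M.offerFrom A τ ω ≤ M.offerFrom A ρ ω) ∧
    (M.offerFrom B τ ω < M.offerFrom B σ ω → M.offerFrom A ρ ω ≤ M.offerFrom A τ ω) := by
  rcases mem_crossEdges.1 hω with ⟨hb, hs⟩ | ⟨hb, hs⟩
  · have hb' := Finset.disjoint_left.1 hAB hb
    have hs' := Finset.disjoint_right.1 hAB hs
    have h1 := offer_buyer_of_fixed (hA _ hb)
    have h2 := offer_seller_of_fixed (hB _ hs)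
    have h3 := offer_buyer_of_fixed (hA' _ hb)
    rw [heq _ hb'] at h2
    rw [heq' _ hs'] at h3
    simp only [offerFrom, hb, hb', if_true, if_false, heq _ hb']
    omega
  · have hb' := Finset.disjoint_right.1 hAB hb
    have hs' := Finset.disjoint_left.1 hAB hs
    have h1 := offer_seller_of_fixed (hA _ hs)
    have h2 := offer_buyer_of_fixed (hB _ hb)
    have h3 := offer_seller_of_fixed (hA' _ hs)
    rw [heq _ hs'] at h2
    rw [heq' _ hb'] at h3
    simp only [offerFrom, hb, hb', if_true, if_false, heq _ hs']
    omega

/-- The sum of the two offers for a cut trade grows when one side raises its offer. -/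
theorem offer_sum_lt {M : Market I Ω} {A B : Finset I} (hAB : Disjoint A B)
    {τ ρ : I → Ω → ℤ} (heq : ∀ j, j ∉ A → ρ j = τ j)
    {ω : Ω} (hω : ω ∈ M.crossEdges A B) (h : M.offerFrom A τ ω < M.offerFrom A ρ ω) :
    τ (M.buyer ω) ω + τ (M.seller ω) ω < ρ (M.buyer ω) ω + ρ (M.seller ω) ω := by
  rcases mem_crossEdges.1 hω with ⟨hb, hs⟩ | ⟨hb, hs⟩
  · have hs' := Finset.disjoint_right.1 hAB hs
    simp only [offerFrom, hb, if_true] at h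
    rw [heq _ hs']
    omega
  · have hb' := Finset.disjoint_right.1 hAB hb
    simp only [offerFrom, hb', if_false] at h
    rw [heq _ hb']
    omega

/-- Alternately settling the two sides of a two-trade cut terminates also when the offers on
the two cut trades move in opposite directions. -/
theorem FSM.exists_reach_of_opposite {M : Market I Ω} (h : M.FSM) {T : Finset (I → Ω → ℤ)}
    (hT : M.Closed T) {e f : Ω} {K : ℤ}
    (hK : ∀ σ ∈ T, σ (M.buyer e) e + σ (M.seller e) e ≤ K) (n : ℕ)
    {A B : Finset I} (hAB : Disjoint A B)
    (hA : M.Settles T A) (hB : M.Settles T B) {σ τ : I → Ω → ℤ} (hτ : τ ∈ T)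
    (hAσ : M.FixedOn A σ) (hBτ : M.FixedOn B τ) (heq : ∀ j, j ∉ B → τ j = σ j)
    (hcut : ∀ ω ∈ M.crossEdges A B, ω = e ∨ ω = f)
    (he : e ∈ M.crossEdges A B) (hf : f ∈ M.crossEdges A B)
    (hle : M.offerFrom B σ e < M.offerFrom B τ e)
    (hlf : M.offerFrom B τ f < M.offerFrom B σ f)
    (hn : K - (τ (M.buyer e) e + τ (M.seller e) e) < n) :
    ∃ ρ, M.Reach (A ∪ B) τ ρ ∧ M.FixedOn (A ∪ B) ρ := by
  induction n generalizing A B σ τ with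
  | zero =>
    have := hK τ hτ
    push_cast at hn
    omega
  | succ n ih =>
    obtain ⟨ρ, hτρ, hAρ⟩ := hA τ hτ
    have hρ := hτρ.mem hT hτ
    have heq' : ∀ j, j ∉ A → ρ j = τ j := fun j hj => hτρ.eq_of_notMem hj
    have hmf := (offerFrom_move hAB hAσ hBτ hAρ heq heq' hf).2 hlf
    have hme := (offerFrom_move hAB hAσ hBτ hAρ heq heq' he).1 hle
    suffices hs : ∃ κ, M.Reach (B ∪ A) ρ κ ∧ M.FixedOn (B ∪ A) κ by
      obtain ⟨κ, hρκ, hκ⟩ := hs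
      rw [Finset.union_comm] at hρκ hκ
      exact ⟨κ, (hτρ.mono Finset.subset_union_left).trans hρκ, hκ⟩
    have hcomm := M.crossEdges_comm A B
    rcases hme.lt_or_eq with hlt | heq_e
    · rcases hmf.lt_or_eq with hlt' | heq_f
      · refine ih hAB.symm hB hA hρ hBτ hAρ heq' (hcomm ▸ hcut) (hcomm ▸ he) (hcomm ▸ hf)
          hlt hlt' ?_
        have h1 := offer_sum_lt hAB heq' he hlt
        push_cast at hn
        omega
      · refine h.exists_reach_of_raised hT hAB.symm hρ hBτ hAρ heq' fun ω hω => ?_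
        rcases hcut ω (hcomm ▸ hω) with rfl | rfl
        · exact hlt.le
        · exact heq_f.ge
    · refine h.exists_reach_of_lowered hT hAB.symm hρ hBτ hAρ heq' fun ω hω => ?_
      rcases hcut ω (hcomm ▸ hω) with rfl | rfl
      · exact heq_e.ge
      · exact hmf

/-- Two settling parts joined by at most two trades settle together. -/
theorem FSM.settles_union {M : Market I Ω} (h : M.FSM) {T : Finset (I → Ω → ℤ)}
    (hT : M.Closed T) {A B : Finset I} (hAB : Disjoint A B)
    (hA : M.Settles T A) (hB : M.Settles T B) (hcard : (M.crossEdges A B).card ≤ 2) :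
    M.Settles T (A ∪ B) := by
  intro σ₀ hσ₀
  obtain ⟨σ, hσ₀σ, hAσ⟩ := hA σ₀ hσ₀
  have hσ := hσ₀σ.mem hT hσ₀
  obtain ⟨τ, hστ, hBτ⟩ := hB σ hσ
  have hτ := hστ.mem hT hσ
  have heq : ∀ j, j ∉ B → τ j = σ j := fun j hj => hστ.eq_of_notMem hj
  suffices hs : ∃ ρ, M.Reach (A ∪ B) τ ρ ∧ M.FixedOn (A ∪ B) ρ by
    obtain ⟨ρ, hτρ, hρ⟩ := hs
    exact ⟨ρ, ((hσ₀σ.mono Finset.subset_union_left).trans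
      (hστ.mono Finset.subset_union_right)).trans hτρ, hρ⟩
  by_cases hup : ∀ ω ∈ M.crossEdges A B, M.offerFrom B σ ω ≤ M.offerFrom B τ ω
  · exact h.exists_reach_of_raised hT hAB hτ hAσ hBτ heq hup
  by_cases hdown : ∀ ω ∈ M.crossEdges A B, M.offerFrom B τ ω ≤ M.offerFrom B σ ω
  · exact h.exists_reach_of_lowered hT hAB hτ hAσ hBτ heq hdown
  push Not at hup hdown
  obtain ⟨f, hf, hlf⟩ := hup
  obtain ⟨e, he, hle⟩ := hdown
  have hef : e ≠ f := by
    rintro rfl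
    exact lt_asymm hle hlf
  have hcut : ∀ ω ∈ M.crossEdges A B, ω = e ∨ ω = f := by
    have hsub : {e, f} ⊆ M.crossEdges A B := by
      simp [Finset.insert_subset_iff, he, hf]
    have := Finset.eq_of_subset_of_card_le hsub (by rwa [Finset.card_pair hef])
    intro ω hω
    simpa [← this] using hω
  obtain ⟨K, hK⟩ := (T.image fun σ => σ (M.buyer e) e + σ (M.seller e) e).bddAbove
  exact h.exists_reach_of_opposite hT
    (fun σ hσ => hK (Finset.mem_coe.2 (Finset.mem_image_of_mem _ hσ))) _ hAB hA hB hτ hAσ hBτ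
    heq hcut he hf hle hlf 
    (Int.lt_add_one_of_le (Int.self_le_toNat _))

theorem FSM.settles_of_sparse {M : Market I Ω} (h : M.FSM) (hsp : M.Sparse 2)
    {T : Finset (I → Ω → ℤ)} (hT : M.Closed T) (S : Finset I) : M.Settles T S := by
  induction S using Finset.strongInduction with
  | _ S ih =>
    by_cases hcard : 2 ≤ S.card
    · obtain ⟨A, hAS, hA, hSA, hcut⟩ := hsp S hcard
      have hu := Finset.union_sdiff_of_subset hAS
      rw [← hu]
      refine h.settles_union hT Finset.disjoint_sdiff (ih A ?_) (ih _ ?_) hcut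
      · exact hAS.ssubset_of_ne fun he => by simp [he] at hSA
      · exact Finset.sdiff_ssubset hAS hA
    · intro σ _
      rcases S.eq_empty_or_nonempty with rfl | ⟨i, hi⟩
      · exact ⟨σ, Relation.ReflTransGen.refl, fun i hi => by simp at hi⟩
      · refine ⟨M.bestResponse σ i, Relation.ReflTransGen.single ⟨i, hi, rfl⟩, fun j hj => ?_⟩
        rw [Finset.card_le_one.1 (by omega) j hj i hi, h.bestResponse_idem]

/-- Demanded trades have bounded prices: from above when buying, from below when selling. -/
theorem exists_demand_price_bound (M : Market I Ω) :
    ∃ K : ℤ, ∀ i p, ∀ ω ∈ M.demand i p,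
      (M.buyer ω = i → p ω ≤ K) ∧ (M.seller ω = i → -K ≤ p ω) := by
  refine ⟨∑ x : I × Finset Ω, |M.v x.1 x.2| + ∑ x : I × Finset Ω, |M.v x.1 x.2|,
    fun i p ω hω => ?_⟩
  have hb : ∀ Ψ, |M.v i Ψ| ≤ ∑ x : I × Finset Ω, |M.v x.1 x.2| := fun Ψ =>
    Finset.single_le_sum (f := fun x : I × Finset Ω => |M.v x.1 x.2|)
      (fun x _ => abs_nonneg _) (Finset.mem_univ (i, Ψ))
  have h1 := abs_le.1 (hb (M.demand i p))
  have h2 := abs_le.1 (hb ((M.demand i p).erase ω))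
  have hmax := M.demand_max i p ((M.demand i p).erase ω)
    fun ω' hω' => M.demand_involves i p ω' (Finset.mem_of_mem_erase hω')
  rw [← Finset.add_sum_erase _ _ hω] at hmax
  refine ⟨fun hi => ?_, fun hi => ?_⟩
  · simp only [hi, if_true] at hmax
    omega
  · have hne : M.buyer ω ≠ i := hi ▸ M.buyer_ne_seller ω
    simp only [hi, hne, if_true, if_false] at hmax
    omega

/-- Every offer profile lies in a finite set preserved by best responses. -/
theorem exists_closed (M : Market I Ω) (σ₀ : I → Ω → ℤ) :
    ∃ T : Finset (I → Ω → ℤ), σ₀ ∈ T ∧ M.Closed T := by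
  obtain ⟨B, hB⟩ := M.exists_demand_price_bound
  set K : ℤ := |B| + ∑ x : I × Ω, |σ₀ x.1 x.2| with hK
  have hBK : B ≤ K := by
    have := Finset.sum_nonneg fun (x : I × Ω) (_ : x ∈ Finset.univ) => abs_nonneg (σ₀ x.1 x.2)
    have := le_abs_self B
    omega
  have hσK : ∀ i ω, |σ₀ i ω| ≤ K := fun i ω => by
    have := Finset.single_le_sum (f := fun x : I × Ω => |σ₀ x.1 x.2|)
      (fun x _ => abs_nonneg _) (Finset.mem_univ (i, ω))
    dsimp only at this
    have := abs_nonneg B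
    omega
  set lo : I → Ω → ℤ := fun j ω =>
    if M.buyer ω = j then -K - 1 else if M.seller ω = j then -K else σ₀ j ω with hlo
  set hi : I → Ω → ℤ := fun j ω =>
    if M.buyer ω = j then K else if M.seller ω = j then K + 1 else σ₀ j ω with hhi
  refine ⟨Finset.Icc lo hi, ?_, ?_⟩
  · refine Finset.mem_Icc.2 ⟨fun j ω => ?_, fun j ω => ?_⟩
    · have := abs_le.1 (hσK j ω)
      simp only [hlo]
      split_ifs <;> omega
    · have := abs_le.1 (hσK j ω)
      simp only [hhi]
      split_ifs <;> omega
  · intro σ hσ i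
    obtain ⟨hl, hh⟩ := Finset.mem_Icc.1 hσ
    have key : ∀ j ω, lo j ω ≤ M.bestResponse σ i j ω ∧ M.bestResponse σ i j ω ≤ hi j ω := by
      intro j ω
      by_cases hω : j = i ∧ M.Involves i ω
      · obtain ⟨rfl, hω⟩ := hω
        rw [M.bestResponse_self _ hω]
        have hne := M.buyer_ne_seller ω
        have hls := hl (M.seller ω) ω
        have hlb := hl (M.buyer ω) ω
        have hhs := hh (M.seller ω) ω
        have hhb := hh (M.buyer ω) ω
        have hd := hB j (M.price σ j) ω
        simp only [hlo, hhi, if_true, if_neg hne] at hls hlb hhs hhb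
        rcases hω with rfl | rfl
        · rw [M.response_of_buyer rfl]
          rw [M.price_of_buyer _ rfl] at hd ⊢
          simp only [hlo, hhi, if_true]
          split_ifs with hm
          · have := (hd hm).1 rfl
            omega
          · omega
        · rw [M.response_of_seller rfl]
          rw [M.price_of_seller _ rfl] at hd ⊢
          simp only [hlo, hhi, if_true, if_neg hne]
          split_ifs with hm
          · have := (hd hm).2 rfl
            omega
          · omega
      · have : M.bestResponse σ i j ω = σ j ω := by
          by_cases hj : j = i
          · exact M.bestResponse_of_not_involves _ _ fun h => hω ⟨hj, h⟩
          · rw [M.bestResponse_of_ne _ hj]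
        rw [this]
        exact ⟨hl j ω, hh j ω⟩
    exact Finset.mem_Icc.2 ⟨fun j ω => (key j ω).1, fun j ω => (key j ω).2⟩

/-- The offers stay in `T` and every agent outside the unsatisfied set best responds. -/
def Consistent (M : Market I Ω) (T : Finset (I → Ω → ℤ)) (s : MState I Ω) : Prop :=
  s.offers ∈ T ∧ ∀ i, i ∉ s.unsat → M.bestResponse s.offers i = s.offers

/-- One step of the dynamic by some unsatisfied agent. -/
def Step (M : Market I Ω) (s t : MState I Ω) : Prop := ∃ i ∈ s.unsat, t = M.mstep s i

theorem FSM.consistent_mstep {M : Market I Ω} (h : M.FSM) {T : Finset (I → Ω → ℤ)}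
    (hT : M.Closed T) {s : MState I Ω} (hs : M.Consistent T s) (i : I) :
    M.Consistent T (M.mstep s i) := by
  refine ⟨hT _ hs.1 i, fun j hj => ?_⟩
  change M.bestResponse (M.bestResponse s.offers i) j = M.bestResponse s.offers i
  by_cases hji : j = i
  · rw [hji, h.bestResponse_idem]
  simp only [mstep, Finset.mem_union, Finset.mem_erase, Finset.mem_filter, Finset.mem_univ,
    true_and, not_or, not_and, not_exists, not_not] at hj
  obtain ⟨hj, hj'⟩ := hj
  have hfix := hs.2 j (hj hji)
  have hsame := hj' hji
  funext k
  by_cases hk : k = j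
  · subst hk
    funext ω
    by_cases hω : M.Involves k ω
    · rw [M.bestResponse_of_ne s.offers hji]
      conv_rhs => rw [← hfix]
      rw [M.bestResponse_self _ hω, M.bestResponse_self _ hω]
      refine h.response_congr (fun ω hω => ?_) hω
      rcases hω with hω | hω
      · rw [M.price_of_buyer _ hω, M.price_of_buyer _ hω]
        by_cases hi : M.seller ω = i
        · rw [hi]
          exact hsame ω (Or.inr ⟨hω, hi⟩)
        · rw [M.bestResponse_of_ne _ hi]
      · rw [M.price_of_seller _ hω, M.price_of_seller _ hω]
        by_cases hi : M.buyer ω = i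
        · rw [hi]
          exact hsame ω (Or.inl ⟨hi, hω⟩)
        · rw [M.bestResponse_of_ne _ hi]
    · rw [M.bestResponse_of_not_involves _ _ hω]
  · rw [M.bestResponse_of_ne _ hk]

theorem mstep_of_fixed {M : Market I Ω} {s : MState I Ω} {i : I}
    (h : M.bestResponse s.offers i = s.offers) :
    M.mstep s i = ⟨s.unsat.erase i, s.offers⟩ := by
  simp [mstep, h]

/-- If all agents best respond, the dynamic can terminate. -/
theorem exists_steps_of_fixedOn {M : Market I Ω} {σ : I → Ω → ℤ}
    (h : M.FixedOn Finset.univ σ) (U : Finset I) :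
    ∃ t, Relation.ReflTransGen M.Step ⟨U, σ⟩ t ∧ t.unsat = ∅ := by
  induction U using Finset.strongInduction with
  | _ U ih =>
    rcases U.eq_empty_or_nonempty with rfl | ⟨i, hi⟩
    · exact ⟨_, Relation.ReflTransGen.refl, rfl⟩
    · obtain ⟨t, ht, he⟩ := ih (U.erase i) (Finset.erase_ssubset hi)
      exact ⟨t, Relation.ReflTransGen.head
        ⟨i, hi, (mstep_of_fixed (h i (Finset.mem_univ i))).symm⟩ ht, he⟩

theorem FSM.exists_terminating_steps {M : Market I Ω} (h : M.FSM) (hsp : M.Sparse 2)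
    {T : Finset (I → Ω → ℤ)} (hT : M.Closed T) {s : MState I Ω} (hs : M.Consistent T s) :
    ∃ t, Relation.ReflTransGen M.Step s t ∧ t.unsat = ∅ := by
  obtain ⟨τ, hr, hτ⟩ := h.settles_of_sparse hsp hT Finset.univ s.offers hs.1
  obtain ⟨U, σ⟩ := s
  change M.Reach Finset.univ σ τ at hr
  induction hr using Relation.ReflTransGen.head_induction_on generalizing U with
  | refl => exact exists_steps_of_fixedOn hτ U
  | head hstep _ ih =>
    obtain ⟨i, _, rfl⟩ := hstep
    by_cases hi : i ∈ U
    · obtain ⟨t, ht, he⟩ := ih _ (h.consistent_mstep hT hs i)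
      exact ⟨t, Relation.ReflTransGen.head ⟨i, hi, rfl⟩ ht, he⟩
    · have hfix := hs.2 i hi
      simp only at hfix
      rw [hfix] at ih
      exact ih U hs

end Dynamics

section Probability

set_option linter.unusedSectionVars false

variable {I Ω : Type} [Fintype I] [DecidableEq I] [Fintype Ω] [DecidableEq Ω]

theorem termProb_of_unsat_empty (M : Market I Ω) {s : MState I Ω} (hs : s.unsat = ∅) (n : ℕ) :
    M.termProb s n = 1 := by
  cases n <;> simp [termProb, hs]

theorem termProb_succ (M : Market I Ω) {s : MState I Ω} (hs : s.unsat ≠ ∅) (n : ℕ) :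
    M.termProb s (n + 1) =
      (s.unsat.card : ℝ)⁻¹ * ∑ i ∈ s.unsat, M.termProb (M.mstep s i) n := by
  simp [termProb, hs]

theorem termProb_nonneg (M : Market I Ω) (s : MState I Ω) (n : ℕ) : 0 ≤ M.termProb s n := by
  induction n generalizing s with
  | zero => unfold termProb; split_ifs <;> norm_num
  | succ n ih =>
    unfold termProb
    split_ifs
    · norm_num
    · exact mul_nonneg (by positivity) (Finset.sum_nonneg fun i _ => ih _)

theorem termProb_le_one (M : Market I Ω) (s : MState I Ω) (n : ℕ) : M.termProb s n ≤ 1 := by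
  induction n generalizing s with
  | zero => unfold termProb; split_ifs <;> norm_num
  | succ n ih =>
    by_cases hs : s.unsat = ∅
    · rw [M.termProb_of_unsat_empty hs]
    · have hc : (0 : ℝ) < s.unsat.card := by
        exact_mod_cast Finset.card_pos.2 (Finset.nonempty_iff_ne_empty.2 hs)
      rw [M.termProb_succ hs, inv_mul_le_iff₀ hc]
      simpa using Finset.sum_le_card_nsmul s.unsat _ 1 fun i _ => ih (M.mstep s i)

theorem termProb_monotone (M : Market I Ω) (s : MState I Ω) : Monotone (M.termProb s) := by
  refine monotone_nat_of_le_succ fun n => ?_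
  induction n generalizing s with
  | zero =>
    by_cases hs : s.unsat = ∅
    · simp [M.termProb_of_unsat_empty hs]
    · have : M.termProb s 0 = 0 := by simp [termProb, hs]
      rw [this]
      exact M.termProb_nonneg _ _
  | succ n ih =>
    by_cases hs : s.unsat = ∅
    · simp [M.termProb_of_unsat_empty hs]
    · rw [M.termProb_succ hs, M.termProb_succ hs]
      gcongr with i _
      exact ih _

/-- The probability that the dynamic ever terminates. -/
noncomputable def limitProb (M : Market I Ω) (s : MState I Ω) : ℝ := ⨆ n, M.termProb s n

theorem tendsto_termProb (M : Market I Ω) (s : MState I Ω) :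
    Filter.Tendsto (M.termProb s) Filter.atTop (nhds (M.limitProb s)) :=
  tendsto_atTop_ciSup (M.termProb_monotone s)
    ⟨1, by rintro _ ⟨n, rfl⟩; exact M.termProb_le_one s n⟩

theorem limitProb_of_unsat_empty (M : Market I Ω) {s : MState I Ω} (hs : s.unsat = ∅) :
    M.limitProb s = 1 := by
  simp [limitProb, M.termProb_of_unsat_empty hs]

/-- The termination probability is the average of those after one step. -/
theorem card_mul_limitProb (M : Market I Ω) {s : MState I Ω} (hs : s.unsat ≠ ∅) :
    s.unsat.card * M.limitProb s = ∑ i ∈ s.unsat, M.limitProb (M.mstep s i) := by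
  have hc : (s.unsat.card : ℝ) ≠ 0 := by
    exact_mod_cast (Finset.card_pos.2 (Finset.nonempty_iff_ne_empty.2 hs)).ne'
  have h1 := (M.tendsto_termProb s).comp (Filter.tendsto_add_atTop_nat 1)
  have h2 : Filter.Tendsto (fun n => M.termProb s (n + 1)) Filter.atTop
      (nhds ((s.unsat.card : ℝ)⁻¹ * ∑ i ∈ s.unsat, M.limitProb (M.mstep s i))) := by
    simp only [M.termProb_succ hs]
    exact (tendsto_finsetSum _ fun i _ => M.tendsto_termProb _).const_mul _
  rw [tendsto_nhds_unique h1 h2, mul_inv_cancel_left₀ hc]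

/-- In a finite closed set of states, each of which can reach termination, the termination
probability is one. -/
theorem limitProb_eq_one {M : Market I Ω} {C : Set (MState I Ω)} (hfin : C.Finite)
    (hC : ∀ s ∈ C, ∀ i, M.mstep s i ∈ C)
    (hterm : ∀ s ∈ C, ∃ t, Relation.ReflTransGen M.Step s t ∧ t.unsat = ∅)
    {s : MState I Ω} (hs : s ∈ C) : M.limitProb s = 1 := by
  obtain ⟨m, hm, hmin⟩ := Set.exists_min_image C M.limitProb hfin ⟨s, hs⟩
  obtain ⟨t, ht, hempty⟩ := hterm m hm
  have key : t ∈ C ∧ M.limitProb t = M.limitProb m := by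
    clear hempty
    induction ht with
    | refl => exact ⟨hm, rfl⟩
    | @tail a b _ hstep ih =>
      obtain ⟨i, hi, rfl⟩ := hstep
      refine ⟨hC _ ih.1 i, ?_⟩
      have hsum := M.card_mul_limitProb (Finset.ne_empty_of_mem hi)
      rw [ih.2, ← nsmul_eq_mul, ← Finset.sum_const] at hsum
      exact ((Finset.sum_eq_sum_iff_of_le fun j _ => hmin _ (hC _ ih.1 j)).1 hsum i hi).symm
  refine le_antisymm (ciSup_le fun n => M.termProb_le_one s n) ?_
  rw [← M.limitProb_of_unsat_empty hempty, key.2]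
  exact hmin s hs

theorem finite_consistent (M : Market I Ω) (T : Finset (I → Ω → ℤ)) :
    {s | M.Consistent T s}.Finite := by
  refine ((Set.finite_univ (α := Finset I)).prod T.finite_toSet |>.image
    fun x => (⟨x.1, x.2⟩ : MState I Ω)).subset fun s hs => ?_
  exact ⟨(s.unsat, s.offers), ⟨Set.mem_univ _, hs.1⟩, rfl⟩

end Probability

end Market

/-- Every 2-sparse market in which all agents have fully substitutable
demands converges almost surely to equilibrium under the market dynamic started with
all agents unsatisfied. -/
theorem two_sparse_FSM_converges_almost_surely
    {I Ω : Type} [Fintype I] [DecidableEq I] [Fintype Ω] [DecidableEq Ω]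
    (M : Market I Ω) (hN : M.Normalized) (hFS : M.FSM) (hsparse : M.Sparse 2)
    (σ0 : I → Ω → ℤ) :
    M.ConvergesAlmostSurely ⟨Finset.univ, σ0⟩ := by
  obtain ⟨T, hσT, hT⟩ := M.exists_closed σ0
  have hlim : M.limitProb ⟨Finset.univ, σ0⟩ = 1 :=
    Market.limitProb_eq_one (M.finite_consistent T)
      (fun s hs i => hFS.consistent_mstep hT hs i)
      (fun s hs => hFS.exists_terminating_steps hsparse hT hs)
      ⟨hσT, fun i hi => absurd (Finset.mem_univ i) hi⟩
  have := M.tendsto_termProb ⟨Finset.univ, σ0⟩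
  rwa [hlim] at this
end

section
/- In a two-agent market with two trades, the alternating best response dynamic terminates if and only if its best response sequence contains two identical consecutive columns, i.e., two consecutive best responses (one by each agent) with the same accept/reject pattern on both trades. -/
open Finset

namespace Market

variable {Ω : Type} [Fintype Ω] [DecidableEq Ω]

/-- The alternating best response dynamic of a two-agent market, starting with agent `a`:
`altRun M s a n` is the state after `n` best responses. -/
def altRun (M : Market Bool Ω) : MState Bool Ω → Bool → ℕ → MState Bool Ω
  | s, _, 0 => s
  | s, a, n + 1 => M.altRun (M.mstep s a) (!a) n

/-- The alternating best response dynamic terminates (all agents become satisfied). -/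
def AltConverges (M : Market Bool Ω) (s : MState Bool Ω) (a : Bool) : Prop :=
  ∃ n : ℕ, (M.altRun s a n).unsat = ∅

end Market

/-- The agent performing the `n`-th best response (0-indexed) of the alternating dynamic
started by agent `a`. -/
def altAgent (a : Bool) (n : ℕ) : Bool := if n % 2 = 0 then a else !a

namespace Market

variable {Ω : Type} [Fintype Ω] [DecidableEq Ω]

/-- The accept/reject column entries of the alternating best response sequence:
`col M s a n ω = true` means the `n`-th best response accepts (demands) trade `ω`
("A"), and `false` means it rejects it ("R"). -/
def col (M : Market Bool Ω) (s : MState Bool Ω) (a : Bool) (n : ℕ) (ω : Ω) : Bool :=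
  decide (ω ∈ M.demand (altAgent a n) (M.price (M.altRun s a n).offers (altAgent a n)))

end Market

theorem altAgent_succ (a : Bool) (n : ℕ) : altAgent a (n + 1) = !(altAgent a n) := by
  unfold altAgent
  split_ifs <;> first | omega | simp

theorem altAgent_not (a : Bool) (n : ℕ) : altAgent (!a) n = altAgent a (n + 1) := by
  rw [altAgent_succ]
  unfold altAgent
  split_ifs <;> rfl

namespace Market

/-- After agent `i` responds, the response of `!i` leaves her offer for `ω` unchanged
exactly when both agents accept `ω` or both reject it. -/
theorem bestResponse_bestResponse_eq_iff {Ω : Type} [DecidableEq Ω]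
    (M : Market Bool Ω) (σ : Bool → Ω → ℤ) (i : Bool) (ω : Ω) :
    M.bestResponse (M.bestResponse σ i) (!i) (!i) ω = M.bestResponse σ i (!i) ω ↔
      (ω ∈ M.demand i (M.price σ i) ↔
        ω ∈ M.demand (!i) (M.price (M.bestResponse σ i) (!i))) := by
  have hne := M.buyer_ne_seller ω
  by_cases h₁ : ω ∈ M.demand i (M.price σ i) <;>
  by_cases h₂ : ω ∈ M.demand (!i) (M.price (M.bestResponse σ i) (!i)) <;>
  rcases hb : M.buyer ω <;> rcases hs : M.seller ω <;> cases i <;>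
  simp_all [bestResponse, price, chi]

variable {Ω : Type} [Fintype Ω] [DecidableEq Ω]

theorem altRun_succ (M : Market Bool Ω) (s : MState Bool Ω) (a : Bool) (n : ℕ) :
    M.altRun s a (n + 1) = M.mstep (M.altRun s a n) (altAgent a n) := by
  induction n generalizing s a with
  | zero => rfl
  | succ n ih =>
    rw [altRun, ih, altAgent_not, ← altRun]

/-- The response of `!i` following that of `i` satisfies both agents exactly when the two
responses accept the same trades. -/
theorem unsat_mstep_mstep_eq_empty_iff (M : Market Bool Ω) (s : MState Bool Ω) (i : Bool) :
    (M.mstep (M.mstep s i) (!i)).unsat = ∅ ↔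
      ∀ ω, ω ∈ M.demand i (M.price s.offers i) ↔
        ω ∈ M.demand (!i) (M.price (M.mstep s i).offers (!i)) := by
  have hinv : ∀ ω, (M.buyer ω = !i ∧ M.seller ω = i) ∨ (M.buyer ω = i ∧ M.seller ω = !i) := by
    intro ω
    have hne := M.buyer_ne_seller ω
    cases hb : M.buyer ω <;> cases hs : M.seller ω <;> cases i <;> simp_all
  have hi : i ∉ (M.mstep s i).unsat := by simp [mstep]
  have hempty : (M.mstep (M.mstep s i) (!i)).unsat = ∅ ↔
      ∀ ω, M.bestResponse (M.mstep s i).offers (!i) (!i) ω = (M.mstep s i).offers (!i) ω := by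
    rw [mstep, Finset.eq_empty_iff_forall_notMem]
    constructor
    · intro h ω
      by_contra hω
      refine h i (Finset.mem_union_right _
        (Finset.mem_filter.2 ⟨Finset.mem_univ _, ?_, ω, hinv ω, hω⟩))
      cases i <;> decide
    · intro h j hj
      rcases Finset.mem_union.1 hj with hj | hj
      · obtain ⟨hji, hj⟩ := Finset.mem_erase.1 hj
        obtain rfl : j = i := by cases i <;> cases j <;> simp_all
        exact hi hj
      · obtain ⟨-, -, ω, -, hω⟩ := Finset.mem_filter.1 hj
        exact hω (h ω)
  rw [hempty]
  exact forall_congr' fun ω => M.bestResponse_bestResponse_eq_iff s.offers i ω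

theorem unsat_altRun_add_two_eq_empty_iff (M : Market Bool Ω) (s : MState Bool Ω) (a : Bool)
    (n : ℕ) :
    (M.altRun s a (n + 2)).unsat = ∅ ↔ ∀ ω, M.col s a n ω = M.col s a (n + 1) ω := by
  rw [altRun_succ, altAgent_succ, altRun_succ, unsat_mstep_mstep_eq_empty_iff]
  refine forall_congr' fun ω => ?_
  rw [col, col, decide_eq_decide, altAgent_succ, altRun_succ]

end Market

/-- In a two-agent market with two trades, the alternating best response
dynamic terminates iff its best response sequence contains two identical consecutive
columns (the same accept/reject pattern on both trades in two consecutive best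
responses). -/
theorem terminates_iff_identical_consecutive_columns
    (M : Market Bool (Fin 2)) (hN : M.Normalized)
    (σ0 : Bool → Fin 2 → ℤ) (a : Bool) :
    M.AltConverges ⟨Finset.univ, σ0⟩ a ↔
      ∃ n : ℕ, ∀ ω : Fin 2,
        M.col ⟨Finset.univ, σ0⟩ a n ω = M.col ⟨Finset.univ, σ0⟩ a (n + 1) ω := by
  simp only [← Market.unsat_altRun_add_two_eq_empty_iff]
  constructor
  · rintro ⟨n, hn⟩
    match n, hn with
    | 0, hn => exact absurd hn Finset.univ_nonempty.ne_empty
    | 1, hn =>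
      have hmem : (!a) ∈ (M.altRun ⟨Finset.univ, σ0⟩ a 1).unsat :=
        Finset.mem_union_left _ (Finset.mem_erase.2 ⟨by cases a <;> decide, Finset.mem_univ _⟩)
      rw [hn] at hmem
      exact absurd hmem (Finset.notMem_empty _)
    | n + 2, hn => exact ⟨n, hn⟩
  · rintro ⟨n, hn⟩
    exact ⟨n + 2, hn⟩
end
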